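/- Let n ≥ 1 and 1 ≤ d₁ < d₂ ≤ n−1. Then (ω((n, {d₁, d₂})) : ℤ) = C(n, d₁)·C(n − d₁, d₂ − d₁) − C(n, d₁) − C(n, d₂) + 1, where ω is the descent weight and C(·,·) the binomial coefficient. -/

import Mathlib

inductive PTree : Type
  | leaf : PTree
  | node : PTree → PTree → PTree
  deriving DecidableEq

namespace PTree

/-- The grade of a planar binary rooted tree: its number of binary (internal) nodes. -/
def grade : PTree → ℕ
  | leaf => 0
  | node t1 t2 => grade t1 + grade t2 + 1

/-- The weight character of a planar binary rooted tree. -/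
def alpha : PTree → ℕ
  | leaf => 1
  | node t1 t2 => Nat.choose (grade t1 + grade t2) (grade t1) * alpha t1 * alpha t2

end PTree

/-- The (finite) set of all planar binary rooted trees of a given grade. -/
def treesOfGrade : ℕ → Finset PTree
  | 0 => {PTree.leaf}
  | n + 1 =>
    (Finset.range (n + 1)).attach.biUnion fun j =>
      (treesOfGrade j.1 ×ˢ treesOfGrade (n - j.1)).image fun p => PTree.node p.1 p.2
termination_by n => n
decreasing_by
  · exact Finset.mem_range.mp j.2
  · exact Nat.lt_succ_of_le (Nat.sub_le n j.1)

/-- A descent: a grade `n` together with a subset of `{1, …, n-1}`. -/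
structure Descent : Type where
  grade : ℕ
  dset : Finset ℕ
  valid : dset ⊆ Finset.Icc 1 (grade - 1)

instance : DecidableEq Descent := fun a b =>
  decidable_of_iff (a.grade = b.grade ∧ a.dset = b.dset) (by
    constructor
    · rintro ⟨h1, h2⟩
      obtain ⟨g1, s1, v1⟩ := a
      obtain ⟨g2, s2, v2⟩ := b
      dsimp at h1 h2
      subst h1; subst h2; rfl
    · rintro rfl; exact ⟨rfl, rfl⟩)

/-- The empty descent `∅₀` of grade `0`. -/
def emptyDescent : Descent := ⟨0, ∅, by simp⟩

/-- The grafting product of two descents. -/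
def dstar (a b : Descent) : Descent where
  grade := a.grade + b.grade + 1
  dset := a.dset ∪ b.dset.image (fun e => e + a.grade + 1) ∪
    (if 1 ≤ a.grade then {a.grade} else ∅)
  valid := by
    intro x hx
    simp only [Finset.mem_union, Finset.mem_image] at hx
    simp only [Finset.mem_Icc]
    rcases hx with (hx | hx) | hx
    · have h := Finset.mem_Icc.mp (a.valid hx); omega
    · obtain ⟨e, he, rfl⟩ := hx
      have h := Finset.mem_Icc.mp (b.valid he); omega
    · split_ifs at hx with h
      · rw [Finset.mem_singleton] at hx; omega
      · simp at hx

/-- The descent of a planar binary rooted tree. -/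
def desc : PTree → Descent
  | .leaf => emptyDescent
  | .node t1 t2 => dstar (desc t1) (desc t2)

/-- The weight of a descent: the sum of the weight characters `α(τ)` over all (finitely many)
planar binary rooted trees `τ` with `desc τ = d`. -/
noncomputable def omegaD (d : Descent) : ℕ :=
  ∑ᶠ (τ : PTree) (_ : desc τ = d), PTree.alpha τ

/-- The (finite) set of all descents of a given grade. -/
def descentsOfGrade (n : ℕ) : Finset Descent :=
  (Finset.Icc 1 (n - 1)).powerset.attach.image fun D =>
    ⟨n, D.1, Finset.mem_powerset.mp D.2⟩

theorem mem_trees (τ : PTree) : ∀ n, τ ∈ treesOfGrade n ↔ τ.grade = n := by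
  induction τ with
  | leaf =>
    intro n
    cases n with
    | zero => simp [treesOfGrade, PTree.grade]
    | succ n => simp [treesOfGrade, PTree.grade]
  | node a b iha ihb =>
    intro n
    cases n with
    | zero => simp [treesOfGrade, PTree.grade]
    | succ n =>
      rw [treesOfGrade]
      simp only [Finset.mem_biUnion, Finset.mem_image, Finset.mem_product, Prod.exists,
        PTree.node.injEq, PTree.grade, Finset.mem_attach, true_and, Subtype.exists,
        Finset.mem_range]
      constructor
      · rintro ⟨j, hj, x, y, ⟨hx, hy⟩, rfl, rfl⟩
        rw [iha] at hx
        rw [ihb] at hy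
        omega
      · intro h
        exact ⟨a.grade, by omega, a, b, ⟨(iha _).2 rfl, (ihb _).2 (by omega)⟩, rfl, rfl⟩

theorem desc_grade (τ : PTree) : (desc τ).grade = τ.grade := by
  induction τ with
  | leaf => rfl
  | node a b iha ihb => simp [desc, dstar, PTree.grade, iha, ihb]

/-- weight of a set in a given grade, as an integer -/
def wt (n : ℕ) (D : Finset ℕ) : ℤ :=
  ∑ τ ∈ treesOfGrade n, if (desc τ).dset = D then (τ.alpha : ℤ) else 0

theorem omegaD_eq (d : Descent) : (omegaD d : ℤ) = wt d.grade d.dset := by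
  have key : omegaD d = ∑ τ ∈ (treesOfGrade d.grade).filter (fun τ => (desc τ).dset = d.dset),
      τ.alpha := by
    rw [omegaD, ← finsum_mem_coe_finset]
    congr 1
    funext τ
    have : (desc τ = d) ↔ τ ∈ (↑((treesOfGrade d.grade).filter
        (fun τ => (desc τ).dset = d.dset)) : Set PTree) := by
      simp only [Finset.coe_filter, Set.mem_ofPred_eq, mem_trees, ← desc_grade]
      constructor
      · rintro rfl; exact ⟨rfl, rfl⟩
      · rintro ⟨h1, h2⟩
        generalize desc τ = e at *
        cases e; cases d; simp_all
    rw [this]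
  rw [key, wt, ← Finset.sum_filter]
  push_cast
  rfl

theorem wt_invalid (n : ℕ) (D : Finset ℕ) (x : ℕ) (hx : x ∈ D) (h : x = 0 ∨ n ≤ x) :
    wt n D = 0 := by
  apply Finset.sum_eq_zero
  intro τ hτ
  rw [mem_trees, ← desc_grade] at hτ
  rw [if_neg]
  rintro rfl
  have := Finset.mem_Icc.1 ((desc τ).valid hx)
  omega

/-- the grafted set -/
def gset (j : ℕ) (a b : Finset ℕ) : Finset ℕ :=
  a ∪ b.image (fun e => e + j + 1) ∪ (if 1 ≤ j then {j} else ∅)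

/-- the contribution of the splitting at `j` -/
def innerW (n j : ℕ) (D : Finset ℕ) : ℤ :=
  ∑ p ∈ treesOfGrade j ×ˢ treesOfGrade (n - j),
    if gset j (desc p.1).dset (desc p.2).dset = D then
      (n.choose j : ℤ) * p.1.alpha * p.2.alpha else 0

theorem wt_succ (n : ℕ) (D : Finset ℕ) :
    wt (n + 1) D = ∑ j ∈ Finset.range (n + 1), innerW n j D := by
  rw [wt, treesOfGrade, Finset.sum_biUnion]
  · rw [← Finset.sum_attach (Finset.range (n + 1))]
    apply Finset.sum_congr rfl
    rintro ⟨j, hj⟩ -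
    rw [Finset.sum_image]
    · apply Finset.sum_congr rfl
      rintro ⟨x, y⟩ hp
      rw [Finset.mem_product, mem_trees, mem_trees] at hp
      obtain ⟨hx, hy⟩ := hp
      simp only at hx hy
      rw [Finset.mem_range] at hj
      have h1 : j + y.grade = n := by omega
      simp only [desc, dstar, gset, desc_grade, PTree.alpha, h1, hx]
      push_cast
      rfl
    · rintro ⟨x, y⟩ - ⟨x', y'⟩ - h
      simpa using h
  · rintro ⟨i, hi⟩ - ⟨j, hj⟩ - hij
    rw [Function.onFun, Finset.disjoint_left]
    intro t ht ht'
    simp only [Finset.mem_image, Finset.mem_product, Prod.exists, mem_trees] at ht ht'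
    obtain ⟨x, y, ⟨hx, hy⟩, rfl⟩ := ht
    obtain ⟨x', y', ⟨hx', hy'⟩, h⟩ := ht'
    cases h
    apply hij
    apply Subtype.ext
    simp only
    omega

theorem inner_split (n j : ℕ) (D A B : Finset ℕ)
    (h : ∀ a b : Finset ℕ, (∀ x ∈ a, 1 ≤ x ∧ x < j) → (∀ x ∈ b, 1 ≤ x) →
      (gset j a b = D ↔ a = A ∧ b = B)) :
    innerW n j D = n.choose j * wt j A * wt (n - j) B := by
  rw [innerW, wt, wt, mul_assoc, Finset.sum_mul_sum, ← Finset.sum_product', Finset.mul_sum]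
  apply Finset.sum_congr rfl
  rintro ⟨x, y⟩ hp
  rw [Finset.mem_product, mem_trees, mem_trees, ← desc_grade, ← desc_grade] at hp
  have := h (desc x).dset (desc y).dset
    (fun z hz => by
      have := Finset.mem_Icc.1 ((desc x).valid hz)
      simp only at hp
      omega)
    (fun z hz => (Finset.mem_Icc.1 ((desc y).valid hz)).1)
  simp only [this]
  by_cases h1 : (desc x).dset = A <;> by_cases h2 : (desc y).dset = B <;> simp [h1, h2, mul_assoc]

theorem inner_zero (n j : ℕ) (D : Finset ℕ) (h0 : 1 ≤ j) (hj : j ∉ D) : innerW n j D = 0 := by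
  apply Finset.sum_eq_zero
  rintro p -
  rw [if_neg]
  rintro rfl
  apply hj
  simp [gset, h0]

theorem wt_empty (n : ℕ) : wt n ∅ = 1 := by
  induction n with
  | zero => simp [wt, treesOfGrade, desc, emptyDescent, PTree.alpha]
  | succ n ih =>
    rw [wt_succ, Finset.sum_eq_single 0]
    · rw [inner_split n 0 ∅ ∅ ∅]
      · have : wt 0 ∅ = 1 := by simp [wt, treesOfGrade, desc, emptyDescent, PTree.alpha]
        simp [this, ih]
      · intro a b _ _
        simp [gset]
    · intro j _ hj
      exact inner_zero _ _ _ (by omega) (by simp)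
    · simp

theorem wt_zero_empty : wt 0 ∅ = 1 := wt_empty 0

theorem gset_zero (a b D : Finset ℕ) (ha : ∀ x ∈ a, 1 ≤ x ∧ x < 0) (hD : ∀ x ∈ D, 1 ≤ x) :
    gset 0 a b = D ↔ a = ∅ ∧ b = D.image (fun x => x - 1) := by
  have : a = ∅ := by
    ext x
    constructor
    · intro hx
      have := ha x hx
      omega
    · simp
  subst this
  simp only [gset, true_and]
  constructor
  · rintro rfl
    simp [Finset.image_image, Function.comp_def]
  · rintro rfl
    ext x
    simp only [Finset.image_image]
    simp
    constructor
    · rintro ⟨y, hy, rfl⟩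
      have := hD y hy
      rwa [Nat.sub_add_cancel this]
    · intro hx
      exact ⟨x, hx, Nat.sub_add_cancel (hD x hx)⟩

theorem inner_at_zero (n : ℕ) (D : Finset ℕ) (hD : ∀ x ∈ D, 1 ≤ x) :
    innerW n 0 D = wt n (D.image (fun x => x - 1)) := by
  rw [inner_split n 0 D ∅ (D.image (fun x => x - 1)) (fun a b ha _ => gset_zero a b D ha hD)]
  simp [wt_empty]

/-- The general split: `D = A ∪ {j} ∪ (B + j + 1)`. -/
theorem gset_pos (j : ℕ) (hj : 1 ≤ j) (a b A B : Finset ℕ) (ha : ∀ x ∈ a, 1 ≤ x ∧ x < j)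
    (hA : ∀ x ∈ A, x < j) :
    gset j a b = gset j A B ↔ a = A ∧ b = B := by
  constructor
  · intro h
    have h' : ∀ x, x ∈ gset j a b ↔ x ∈ gset j A B := fun x => by rw [h]
    simp only [gset, hj, if_true, Finset.mem_union, Finset.mem_image, Finset.mem_singleton] at h'
    constructor
    · ext x
      have := h' x
      have := ha x
      have := hA x
      grind
    · ext x
      have := h' (x + j + 1)
      have := ha (x + j + 1)
      have := hA (x + j + 1)
      grind
  · rintro ⟨rfl, rfl⟩
    rfl

theorem inner_pos (n j : ℕ) (hj : 1 ≤ j) (D A B : Finset ℕ) (hA : ∀ x ∈ A, x < j)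
    (hD : D = gset j A B) : innerW n j D = n.choose j * wt j A * wt (n - j) B := by
  subst hD
  exact inner_split n j _ A B (fun a b ha _ => gset_pos j hj a b A B ha hA)

theorem wt_one (n : ℕ) : ∀ d, d ≤ n → wt n {d} = n.choose d - 1 := by
  induction n with
  | zero =>
    intro d hd
    rw [wt_invalid 0 {d} d (by simp) (by omega)]
    have : d = 0 := by omega
    simp [this]
  | succ n ih =>
    intro d hd
    rcases Nat.eq_zero_or_pos d with rfl | h0
    · rw [wt_invalid _ _ 0 (by simp) (by omega)]; simp
    rcases Nat.lt_or_ge n d with h1 | h1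
    · rw [wt_invalid _ _ d (by simp) (by omega)]
      have : d = n + 1 := by omega
      simp [this]
    obtain ⟨e, rfl⟩ : ∃ e, d = e + 1 := ⟨d - 1, by omega⟩
    have key : ∀ j ∈ Finset.range (n + 1), innerW n j {e + 1} =
        (if j = 0 then wt n {e} else 0) + (if j = e + 1 then (n.choose (e + 1) : ℤ) else 0) := by
      intro j _
      by_cases hj0 : j = 0
      · subst hj0
        rw [inner_at_zero _ _ (by simp)]
        simp
      by_cases hj1 : j = e + 1
      · subst hj1
        rw [inner_pos n (e + 1) (by omega) {e + 1} ∅ ∅ (by simp) (by simp [gset])]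
        simp [wt_empty]
      · rw [inner_zero _ _ _ (by omega) (by simpa using hj1)]
        simp [hj0, hj1]
    rw [wt_succ, Finset.sum_congr rfl key, Finset.sum_add_distrib, Finset.sum_ite_eq',
      Finset.sum_ite_eq', if_pos (by simp), if_pos (by simp; omega), ih e (by omega),
      Nat.choose_succ_succ]
    push_cast
    ring

theorem wt_two (n : ℕ) : ∀ d k, d + k + 1 ≤ n → wt n {d, d + k + 1} =
    n.choose d * (n - d).choose (k + 1) - n.choose d - n.choose (d + k + 1) + 1 := by
  induction n with
  | zero => intro d k h; omega
  | succ n ih =>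
    intro d k hd
    rcases Nat.eq_zero_or_pos d with rfl | h0
    · rw [wt_invalid _ _ 0 (by simp) (by omega)]; simp
    rcases Nat.lt_or_ge n (d + k + 1) with h1 | h1
    · rw [wt_invalid _ _ (d + k + 1) (by simp) (by omega)]
      have e1 : d + k + 1 = n + 1 := by omega
      have e2 : n + 1 - d = k + 1 := by omega
      rw [e1, e2]
      simp
    obtain ⟨e, rfl⟩ : ∃ e, d = e + 1 := ⟨d - 1, by omega⟩
    have key : ∀ j ∈ Finset.range (n + 1), innerW n j {e + 1, e + 1 + k + 1} =
        (if j = 0 then wt n {e, e + k + 1} else 0) +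
        (if j = e + 1 then (n.choose (e + 1) : ℤ) * wt (n - (e + 1)) {k} else 0) +
        (if j = e + 1 + k + 1 then
          (n.choose (e + 1 + k + 1) : ℤ) * wt (e + 1 + k + 1) {e + 1} else 0) := by
      intro j _
      by_cases hj0 : j = 0
      · subst hj0
        rw [inner_at_zero _ _ (by simp)]
        have : e + 1 + k = e + k + 1 := by omega
        simp [Finset.image_insert, this]
      by_cases hj1 : j = e + 1
      · subst hj1
        rw [inner_pos n (e + 1) (by omega) _ ∅ {k} (by simp) (by
          ext x
          simp [gset]
          omega)]
        simp [wt_empty]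
        omega
      by_cases hj2 : j = e + 1 + k + 1
      · subst hj2
        rw [inner_pos n (e + 1 + k + 1) (by omega) _ {e + 1} ∅ (by simp) (by
          ext x
          simp [gset])]
        simp [wt_empty]
        omega
      · rw [inner_zero _ _ _ (by omega) (by simp; omega)]
        simp [hj0, hj1, hj2]
    rw [wt_succ, Finset.sum_congr rfl key, Finset.sum_add_distrib, Finset.sum_add_distrib,
      Finset.sum_ite_eq', Finset.sum_ite_eq', Finset.sum_ite_eq', if_pos (by simp),
      if_pos (by simp; omega), if_pos (by simp; omega), ih e k (by omega),
      wt_one _ k (by omega), wt_one _ (e + 1) (by omega)]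
    have a1 : (n + 1).choose (e + 1) = n.choose e + n.choose (e + 1) := Nat.choose_succ_succ _ _
    have a2 : (n + 1).choose (e + 1 + k + 1) = n.choose (e + k + 1) + n.choose (e + 1 + k + 1) := by
      rw [Nat.choose_succ_succ]
      congr 2; omega
    have a3 : (n - e).choose (k + 1) =
        (n - (e + 1)).choose k + (n - (e + 1)).choose (k + 1) := by
      have : n - e = n - (e + 1) + 1 := by omega
      rw [this, Nat.choose_succ_succ]
    have a4 : n.choose (e + 1 + k + 1) * (e + 1 + k + 1).choose (e + 1) =
        n.choose (e + 1) * (n - (e + 1)).choose (k + 1) := by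
      rw [Nat.choose_mul (by omega)]
      congr 2; omega
    have a5 : n + 1 - (e + 1) = n - e := by omega
    rw [a5, a1, a2]
    zify at a3 a4
    push_cast
    linear_combination a4 - (n.choose (e + 1) : ℤ) * a3

/-- The length-two weight formula: for `1 ≤ d₁ < d₂ ≤ n−1`,
`ω((n, {d₁, d₂})) = C(n, d₁)·C(n − d₁, d₂ − d₁) − C(n, d₁) − C(n, d₂) + 1`. -/
theorem weight_two_descents (n d₁ d₂ : ℕ) (hn : 1 ≤ n) (h1 : 1 ≤ d₁) (h12 : d₁ < d₂)
    (h2 : d₂ ≤ n - 1) :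
    (omegaD ⟨n, {d₁, d₂}, by
        intro x hx
        simp only [Finset.mem_insert, Finset.mem_singleton] at hx
        rw [Finset.mem_Icc]
        rcases hx with rfl | rfl <;> omega⟩ : ℤ) =
      Nat.choose n d₁ * Nat.choose (n - d₁) (d₂ - d₁) -
        Nat.choose n d₁ - Nat.choose n d₂ + 1 := by
  rw [omegaD_eq]
  have h := wt_two n d₁ (d₂ - d₁ - 1) (by omega)
  have e1 : d₁ + (d₂ - d₁ - 1) + 1 = d₂ := by omega
  have e2 : d₂ - d₁ - 1 + 1 = d₂ - d₁ := by omega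
  rw [e1, e2] at h
  exact h
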